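/- arXiv:2508.20629 — 7 statements merged into one kernel-verified Lean document; each statement's English description precedes it below -/
import Mathlib

section
/- Let A be a connected graded bialgebra over a field k of characteristic p > 0 whose underlying algebra is commutative. Write A⁺ for the internal direct sum of the graded pieces 𝒜 n with n > 0. If the subspace of primitive elements {x ∈ A : Δx = 1 ⊗ x + x ⊗ 1} is finite-dimensional over k, and the space of indecomposables A⁺/(A⁺·A⁺) is finite-dimensional over k, then A is finite-dimensional over k. -/
open TensorProduct Coalgebra

/-- The data of a connected graded bialgebra structure on a bialgebra `A` over `k`,
with grading `𝒜 : ℕ → Submodule k A`. -/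
structure IsConnGradedBialgebra (k : Type*) [CommSemiring k] (A : Type*) [Semiring A]
    [Bialgebra k A] (𝒜 : ℕ → Submodule k A) : Prop where
  /-- `A` is the internal direct sum of the `𝒜 n`. -/
  internal : DirectSum.IsInternal 𝒜
  /-- `1 ∈ 𝒜 0`. -/
  one_mem : (1 : A) ∈ 𝒜 0
  /-- `𝒜 m · 𝒜 n ⊆ 𝒜 (m + n)`. -/
  mul_mem : ∀ m n : ℕ, ∀ a ∈ 𝒜 m, ∀ b ∈ 𝒜 n, a * b ∈ 𝒜 (m + n)
  /-- The comultiplication respects the grading: `Δ(𝒜 n)` lands in the span of the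
  simple tensors `a ⊗ b` with `a ∈ 𝒜 i`, `b ∈ 𝒜 j`, `i + j = n`. -/
  comul_mem : ∀ n : ℕ, ∀ x ∈ 𝒜 n, comul (R := k) x ∈
    Submodule.span k {t : A ⊗[k] A |
      ∃ i j : ℕ, i + j = n ∧ ∃ a ∈ 𝒜 i, ∃ b ∈ 𝒜 j, t = a ⊗ₜ[k] b}
  /-- The counit vanishes in positive degrees. -/
  counit_eq_zero : ∀ n : ℕ, 0 < n → ∀ x ∈ 𝒜 n, counit (R := k) x = 0
  /-- Connectedness: `𝒜 0 = k·1`. -/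
  connected : 𝒜 0 = (1 : Submodule k A)

/-- The submodule of primitive elements `{x | Δx = 1 ⊗ x + x ⊗ 1}` of a bialgebra. -/
noncomputable def primitivesSubmodule (k : Type*) [Field k] (A : Type*) [Ring A]
    [Bialgebra k A] : Submodule k A :=
  LinearMap.ker ((comul (R := k) (A := A)) - TensorProduct.mk k A A 1
    - (TensorProduct.mk k A A).flip 1)

theorem mem_primitivesSubmodule_iff {k : Type*} [Field k] {A : Type*} [Ring A] [Bialgebra k A]
    {x : A} : x ∈ primitivesSubmodule k A ↔ comul (R := k) x = 1 ⊗ₜ[k] x + x ⊗ₜ[k] 1 := by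
  simp [primitivesSubmodule, sub_sub, sub_eq_zero]

/-- An element whose comultiplication splits as `1 ⊗ y + z ⊗ 1` with `y`, `z` in the augmentation
ideal is primitive. -/
theorem mem_primitivesSubmodule_of_comul_eq {k : Type*} [Field k] {A : Type*} [Ring A]
    [Bialgebra k A] {x y z : A} (hy : counit (R := k) y = 0) (hz : counit (R := k) z = 0)
    (h : comul (R := k) x = 1 ⊗ₜ[k] y + z ⊗ₜ[k] 1) : x ∈ primitivesSubmodule k A := by
  have hxy : x = y := by
    have e := rTensor_counit_comul (R := k) x
    rw [h] at e
    have e' := congrArg (TensorProduct.lid k A) e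
    simpa [hz] using e'.symm
  have hxz : x = z := by
    have e := lTensor_counit_comul (R := k) x
    rw [h] at e
    have e' := congrArg (TensorProduct.rid k A) e
    simpa [hy] using e'.symm
  rw [mem_primitivesSubmodule_iff, h, ← hxy, ← hxz]

namespace IsConnGradedBialgebra

variable {k : Type*} [Field k] {A : Type*} [CommRing A] [Bialgebra k A] {𝒜 : ℕ → Submodule k A}

theorem gradedMonoid (h𝒜 : IsConnGradedBialgebra k A 𝒜) : SetLike.GradedMonoid 𝒜 where
  one_mem := h𝒜.one_mem
  mul_mem _ _ _ _ ha hb := h𝒜.mul_mem _ _ _ ha _ hb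

/-- A finite-dimensional subspace contains nonzero homogeneous elements in only finitely many
degrees. -/
theorem exists_finset_forall_eq_zero (h𝒜 : IsConnGradedBialgebra k A 𝒜) (P : Submodule k A)
    [FiniteDimensional k P] : ∃ s : Finset ℕ, ∀ d ∉ s, ∀ x ∈ P, x ∈ 𝒜 d → x = 0 := by
  have hP : P ≤ ⨆ i, 𝒜 i := by
    rw [h𝒜.internal.submodule_iSup_eq_top]
    exact le_top
  obtain ⟨s, hs⟩ := CompleteLattice.IsCompactElement.exists_finset_of_le_iSup _
    ((Submodule.fg_iff_compact P).1 (Module.Finite.iff_fg.1 inferInstance)) 𝒜 hP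
  refine ⟨s, fun d hd x hx hxd => ?_⟩
  have hdisj : Disjoint (𝒜 d) (⨆ i ∈ s, 𝒜 i) :=
    h𝒜.internal.submodule_iSupIndep.disjoint_biSup (y := (s : Set ℕ)) hd
  exact Submodule.disjoint_def.1 hdisj x hxd (hs hx)

/-- If `q = p ^ n` and all homogeneous elements of positive degree less than `m` have vanishing
`q`-th power, then the `q`-th powers of elements of degree `m` are primitive. -/
theorem pow_mem_primitivesSubmodule (h𝒜 : IsConnGradedBialgebra k A 𝒜) (p : ℕ) [Fact p.Prime]
    [CharP k p] (n : ℕ) {m : ℕ} (hm : 0 < m)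
    (hlt : ∀ i < m, 0 < i → ∀ b ∈ 𝒜 i, b ^ p ^ n = 0) {a : A} (ha : a ∈ 𝒜 m) :
    a ^ p ^ n ∈ primitivesSubmodule k A := by
  have : Nontrivial A := (Bialgebra.counitAlgHom k A).toRingHom.domain_nontrivial
  have : Nontrivial (A ⊗[k] A) :=
    (Algebra.TensorProduct.lift (Bialgebra.counitAlgHom k A) (Bialgebra.counitAlgHom k A)
      fun _ _ => Commute.all _ _).toRingHom.domain_nontrivial
  have : CharP (A ⊗[k] A) p :=
    charP_of_injective_algebraMap (algebraMap k (A ⊗[k] A)).injective p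
  have hq : p ^ n ≠ 0 := pow_ne_zero _ (Fact.out : p.Prime).ne_zero
  have hcounit : ∀ j, 0 < j → ∀ b ∈ 𝒜 j, counit (R := k) (b ^ p ^ n) = 0 := fun j hj b hb => by
    rw [Bialgebra.counit_pow, h𝒜.counit_eq_zero j hj b hb, zero_pow hq]
  suffices key : ∃ y z : A, counit (R := k) y = 0 ∧ counit (R := k) z = 0 ∧
      comul (R := k) a ^ p ^ n = 1 ⊗ₜ[k] y + z ⊗ₜ[k] 1 by
    obtain ⟨y, z, hy, hz, h⟩ := key
    exact mem_primitivesSubmodule_of_comul_eq hy hz (by rw [Bialgebra.comul_pow, h])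
  have hmem := h𝒜.comul_mem m a ha
  generalize comul (R := k) a = t at hmem ⊢
  induction hmem using Submodule.span_induction with
  | mem t ht =>
    obtain ⟨i, j, hij, b, hb, c, hc, rfl⟩ := ht
    rw [Algebra.TensorProduct.tmul_pow]
    rcases Nat.eq_zero_or_pos i with rfl | hi
    · rw [h𝒜.connected] at hb
      obtain ⟨r, rfl⟩ := Submodule.mem_one.1 hb
      refine ⟨r ^ p ^ n • c ^ p ^ n, 0, ?_, map_zero _, ?_⟩
      · rw [map_smul, hcounit j (by omega) c hc, smul_zero]
      · rw [← map_pow, Algebra.algebraMap_eq_smul_one, smul_tmul, zero_tmul, add_zero]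
    rcases Nat.eq_zero_or_pos j with rfl | hj
    · rw [h𝒜.connected] at hc
      obtain ⟨r, rfl⟩ := Submodule.mem_one.1 hc
      refine ⟨0, r ^ p ^ n • b ^ p ^ n, map_zero _, ?_, ?_⟩
      · rw [map_smul, hcounit i hi b hb, smul_zero]
      · rw [← map_pow, Algebra.algebraMap_eq_smul_one, ← smul_tmul, tmul_zero, zero_add]
    · refine ⟨0, 0, map_zero _, map_zero _, ?_⟩
      rw [hlt i (by omega) hi b hb]
      simp
  | zero => exact ⟨0, 0, map_zero _, map_zero _, by simp [zero_pow hq]⟩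
  | add t u _ _ ht hu =>
    obtain ⟨y, z, hy, hz, h⟩ := ht
    obtain ⟨y', z', hy', hz', h'⟩ := hu
    refine ⟨y + y', z + z', by simp [hy, hy'], by simp [hz, hz'], ?_⟩
    rw [add_pow_char_pow, h, h', tmul_add, add_tmul]
    abel
  | smul r t _ ht =>
    obtain ⟨y, z, hy, hz, h⟩ := ht
    refine ⟨r ^ p ^ n • y, r ^ p ^ n • z, by simp [hy], by simp [hz], ?_⟩
    rw [smul_pow, h, smul_add, tmul_smul, ← smul_tmul']

/-- In characteristic `p`, if the primitives are finite-dimensional, then some power `p ^ n`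
annihilates all homogeneous elements of positive degree. -/
theorem exists_forall_pow_eq_zero (h𝒜 : IsConnGradedBialgebra k A 𝒜) (p : ℕ) [Fact p.Prime]
    [CharP k p] [FiniteDimensional k (primitivesSubmodule k A)] :
    ∃ n, ∀ m, 0 < m → ∀ a ∈ 𝒜 m, a ^ p ^ n = 0 := by
  obtain ⟨s, hs⟩ := h𝒜.exists_finset_forall_eq_zero (primitivesSubmodule k A)
  have := h𝒜.gradedMonoid
  refine ⟨s.sup id + 1, fun m => ?_⟩
  induction m using Nat.strong_induction_on with
  | _ m ih =>
    intro hm a ha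
    refine hs (p ^ (s.sup id + 1) • m) (fun hmem => ?_) _
      (h𝒜.pow_mem_primitivesSubmodule p _ hm ih ha) (SetLike.pow_mem_graded _ ha)
    have h1 : p ^ (s.sup id + 1) • m ≤ s.sup id := Finset.le_sup (f := id) hmem
    have h2 : s.sup id + 1 < p ^ (s.sup id + 1) :=
      Nat.lt_pow_self (Fact.out : p.Prime).one_lt
    have h3 : p ^ (s.sup id + 1) ≤ p ^ (s.sup id + 1) • m := Nat.le_mul_of_pos_right _ hm
    omega

/-- If the homogeneous components of elements of `W` lie in a subalgebra `B`, and `W` spans the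
augmentation ideal modulo decomposables, then `B` is everything. -/
theorem subalgebra_eq_top_of_le_sup (h𝒜 : IsConnGradedBialgebra k A 𝒜) [GradedAlgebra 𝒜]
    {W : Submodule k A}
    (hW : (⨆ n : ℕ, ⨆ _ : 0 < n, 𝒜 n) ≤
      W ⊔ (⨆ n : ℕ, ⨆ _ : 0 < n, 𝒜 n) * (⨆ n : ℕ, ⨆ _ : 0 < n, 𝒜 n))
    (B : Subalgebra k A) (hB : ∀ n, W ≤ (Subalgebra.toSubmodule B).comap (GradedAlgebra.proj 𝒜 n)) :
    B = ⊤ := by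
  have hle : ∀ n, 𝒜 n ≤ Subalgebra.toSubmodule B := by
    intro n
    induction n using Nat.strong_induction_on with
    | _ n ih =>
      intro a ha
      rcases Nat.eq_zero_or_pos n with rfl | hn
      · rw [h𝒜.connected] at ha
        exact Submodule.one_le.2 B.one_mem ha
      have hsq : (⨆ n : ℕ, ⨆ _ : 0 < n, 𝒜 n) * (⨆ n : ℕ, ⨆ _ : 0 < n, 𝒜 n) ≤
          (Subalgebra.toSubmodule B).comap (GradedAlgebra.proj 𝒜 n) := by
        simp only [Submodule.iSup_mul, Submodule.mul_iSup, iSup_le_iff, Submodule.mul_le]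
        intro i hi j hj b hb c hc
        rw [Submodule.mem_comap, GradedAlgebra.proj_apply]
        by_cases hij : j + i = n
        · rw [DirectSum.decompose_of_mem_same 𝒜 (hij ▸ h𝒜.mul_mem _ _ _ hb _ hc)]
          exact B.mul_mem (ih _ (by omega) hb) (ih _ (by omega) hc)
        · rw [DirectSum.decompose_of_mem_ne 𝒜 (h𝒜.mul_mem _ _ _ hb _ hc) hij]
          exact B.zero_mem
      have hmem := sup_le (hB n) hsq (hW (Submodule.mem_iSup_of_mem n
        (Submodule.mem_iSup_of_mem hn ha)))
      rwa [Submodule.mem_comap, GradedAlgebra.proj_apply,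
        DirectSum.decompose_of_mem_same 𝒜 ha] at hmem
  rw [← Algebra.toSubmodule_eq_top, eq_top_iff, ← h𝒜.internal.submodule_iSup_eq_top]
  exact iSup_le hle

end IsConnGradedBialgebra

/-- A subspace of finite codimension has a finite-dimensional supplement. -/
theorem Submodule.exists_fg_le_sup_of_finite_quotient_comap {k V : Type*} [Field k]
    [AddCommGroup V] [Module k V] (U N : Submodule k V)
    [FiniteDimensional k (U ⧸ N.comap U.subtype)] : ∃ W : Submodule k V, W.FG ∧ U ≤ W ⊔ N := by
  obtain ⟨C, hC⟩ := Submodule.exists_isCompl (N.comap U.subtype)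
  have : FiniteDimensional k C := (Submodule.quotientEquivOfIsCompl _ _ hC).finiteDimensional
  refine ⟨C.map U.subtype, (Module.Finite.iff_fg.1 this).map _, ?_⟩
  calc U = (⊤ : Submodule k U).map U.subtype := (Submodule.map_subtype_top U).symm
    _ = C.map U.subtype ⊔ (N.comap U.subtype).map U.subtype := by
      rw [← Submodule.map_sup, hC.symm.sup_eq_top]
    _ ≤ C.map U.subtype ⊔ N := sup_le_sup_left (Submodule.map_comap_le _ _) _

/-- **Theorem 7.1** (Milnor–Moore style finiteness). Let `A` be a connected graded bialgebra
over a field `k` of characteristic `p > 0` whose underlying algebra is commutative. If the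
space of primitives of `A` is finite-dimensional over `k`, and the space of indecomposables
`A⁺/(A⁺·A⁺)` is finite-dimensional over `k`, then `A` is finite-dimensional over `k`. -/
theorem finiteDimensional_of_finiteDimensional_primitives_indecomposables
    {k : Type*} [Field k] {A : Type*} [CommRing A] [Bialgebra k A]
    (p : ℕ) (hp : 0 < p) [CharP k p]
    (𝒜 : ℕ → Submodule k A) (h𝒜 : IsConnGradedBialgebra k A 𝒜)
    (Aplus : Submodule k A) (hAplus : Aplus = ⨆ n : ℕ, ⨆ _ : 0 < n, 𝒜 n)
    (hprim : FiniteDimensional k (primitivesSubmodule k A))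
    (hindec : FiniteDimensional k (Aplus ⧸ ((Aplus * Aplus).comap Aplus.subtype))) :
    FiniteDimensional k A := by
  have : Fact p.Prime := ⟨(CharP.char_is_prime_or_zero k p).resolve_right hp.ne'⟩
  have := h𝒜.gradedMonoid
  let _ : GradedAlgebra 𝒜 := { h𝒜.internal.chooseDecomposition with }
  obtain ⟨n, hn⟩ := h𝒜.exists_forall_pow_eq_zero p
  have hint : ∀ i, ∀ a ∈ 𝒜 i, IsIntegral k a := fun i a ha => by
    rcases Nat.eq_zero_or_pos i with rfl | hi
    · rw [h𝒜.connected] at ha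
      obtain ⟨r, rfl⟩ := Submodule.mem_one.1 ha
      exact isIntegral_algebraMap
    · refine IsIntegral.of_pow (pow_pos hp n) ?_
      rw [hn i hi a ha]
      exact isIntegral_zero
  obtain ⟨W, ⟨s, rfl⟩, hW⟩ :=
    Submodule.exists_fg_le_sup_of_finite_quotient_comap Aplus (Aplus * Aplus)
  let T : Set A := ⋃ x ∈ s, Set.range fun i => GradedAlgebra.proj 𝒜 i x
  have hT : T.Finite := by
    refine s.finite_toSet.biUnion fun x _ => ?_
    classical
    refine (((DirectSum.decompose 𝒜 x).support.finite_toSet.image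
      fun i => GradedAlgebra.proj 𝒜 i x).insert 0).subset ?_
    rintro _ ⟨i, rfl⟩
    by_cases hi : GradedAlgebra.proj 𝒜 i x = 0
    · exact Or.inl hi
    · exact Or.inr ⟨i, (GradedAlgebra.mem_support_iff 𝒜 x i).2 hi, rfl⟩
  have hTint : ∀ x ∈ T, IsIntegral k x := by
    intro x hx
    simp only [T, Set.mem_iUnion, Set.mem_range] at hx
    obtain ⟨y, _, i, rfl⟩ := hx
    exact hint i _ (SetLike.coe_mem _)
  have htop : Algebra.adjoin k T = ⊤ := by
    refine h𝒜.subalgebra_eq_top_of_le_sup (hAplus ▸ hW) _ fun i => Submodule.span_le.2 fun x hx =>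
      Algebra.subset_adjoin (Set.mem_biUnion hx ⟨i, rfl⟩)
  have hfg := fg_adjoin_of_finite hT hTint
  rw [htop, Algebra.top_toSubmodule] at hfg
  exact ⟨hfg⟩
end

section
/- Let A be a connected graded bialgebra over a field k of characteristic p > 0 whose underlying algebra is commutative. Let n > 0 and x ∈ 𝒜 n, and suppose that every homogeneous element of A of degree m with 0 < m < n is nilpotent. Then there exists N ∈ ℕ such that x^(p^N) is primitive, i.e. Δ(x^(p^N)) = 1 ⊗ x^(p^N) + x^(p^N) ⊗ 1. -/
open TensorProduct Coalgebra

/-- If every homogeneous element of positive degree less than `n` is nilpotent, then the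
comultiplication of `x ∈ 𝒜 n` agrees with `1 ⊗ u + v ⊗ 1`, for some `u, v ∈ 𝒜 n`,
up to a nilpotent element. -/
theorem IsConnGradedBialgebra.exists_isNilpotent_comul_sub
    {k : Type*} [CommRing k] {A : Type*} [CommRing A] [Bialgebra k A]
    {𝒜 : ℕ → Submodule k A} (h𝒜 : IsConnGradedBialgebra k A 𝒜) {n : ℕ} {x : A} (hx : x ∈ 𝒜 n)
    (hnil : ∀ m : ℕ, 0 < m → m < n → ∀ y ∈ 𝒜 m, IsNilpotent y) :
    ∃ u ∈ 𝒜 n, ∃ v ∈ 𝒜 n,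
      IsNilpotent (comul (R := k) x - ((1 : A) ⊗ₜ[k] u + v ⊗ₜ[k] (1 : A))) := by
  have h := h𝒜.comul_mem n x hx
  generalize (comul x : A ⊗[k] A) = s at h ⊢
  induction h using Submodule.span_induction with
  | mem t ht =>
    obtain ⟨i, j, hij, a, ha, b, hb, rfl⟩ := ht
    rcases Nat.eq_zero_or_pos i with rfl | hi
    · rw [h𝒜.connected, Submodule.mem_one] at ha
      obtain ⟨c, rfl⟩ := ha
      obtain rfl : j = n := by omega
      exact ⟨c • b, (𝒜 j).smul_mem c hb, 0, zero_mem _, by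
        simp [Algebra.algebraMap_eq_smul_one, TensorProduct.smul_tmul]⟩
    rcases Nat.eq_zero_or_pos j with rfl | hj
    · rw [h𝒜.connected, Submodule.mem_one] at hb
      obtain ⟨c, rfl⟩ := hb
      obtain rfl : i = n := by omega
      exact ⟨0, zero_mem _, c • a, (𝒜 i).smul_mem c ha, by
        simp [Algebra.algebraMap_eq_smul_one, TensorProduct.smul_tmul]⟩
    · refine ⟨0, zero_mem _, 0, zero_mem _, ?_⟩
      obtain ⟨N, hN⟩ := hnil i hi (by omega) a ha
      exact ⟨N, by simp [hN]⟩
  | zero => exact ⟨0, zero_mem _, 0, zero_mem _, by simp⟩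
  | add s t _ _ hs ht =>
    obtain ⟨u, hu, v, hv, h⟩ := hs
    obtain ⟨u', hu', v', hv', h'⟩ := ht
    refine ⟨u + u', add_mem hu hu', v + v', add_mem hv hv', ?_⟩
    convert (Commute.all _ _).isNilpotent_add h h' using 1
    · rfl
    rw [TensorProduct.tmul_add, TensorProduct.add_tmul]
    abel
  | smul c t _ ht =>
    obtain ⟨u, hu, v, hv, h⟩ := ht
    refine ⟨c • u, Submodule.smul_mem _ c hu, c • v, Submodule.smul_mem _ c hv, ?_⟩
    convert h.smul c using 1
    · rfl
    rw [smul_sub, smul_add, TensorProduct.tmul_smul, ← TensorProduct.smul_tmul' (R := k) c v]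

/-- If every homogeneous element of positive degree less than `n` is nilpotent, then elements of
`𝒜 n` are primitive up to a nilpotent element. -/
theorem IsConnGradedBialgebra.isNilpotent_comul_sub
    {k : Type*} [CommRing k] {A : Type*} [CommRing A] [Bialgebra k A]
    {𝒜 : ℕ → Submodule k A} (h𝒜 : IsConnGradedBialgebra k A 𝒜) {n : ℕ} (hn : 0 < n)
    {x : A} (hx : x ∈ 𝒜 n) (hnil : ∀ m : ℕ, 0 < m → m < n → ∀ y ∈ 𝒜 m, IsNilpotent y) :
    IsNilpotent (comul (R := k) x - ((1 : A) ⊗ₜ[k] x + x ⊗ₜ[k] (1 : A))) := by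
  obtain ⟨u, hu, v, hv, h⟩ := h𝒜.exists_isNilpotent_comul_sub hx hnil
  have hxu : IsNilpotent (x - u) := by
    let f : A ⊗[k] A →ₐ[k] A := (Algebra.TensorProduct.lid k A).toAlgHom.comp
      (Algebra.TensorProduct.map (Bialgebra.counitAlgHom k A) (AlgHom.id k A))
    have hf : f (comul x) = x := by
      have := congrArg (TensorProduct.lid k A) (rTensor_counit_comul (R := k) x)
      rwa [TensorProduct.lid_tmul, one_smul] at this
    have hfx := h.map f
    rw [map_sub, hf] at hfx
    simpa [f, h𝒜.counit_eq_zero n hn v hv] using hfx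
  have hxv : IsNilpotent (x - v) := by
    let f : A ⊗[k] A →ₐ[k] A := (Algebra.TensorProduct.rid k k A).toAlgHom.comp
      (Algebra.TensorProduct.map (AlgHom.id k A) (Bialgebra.counitAlgHom k A))
    have hf : f (comul x) = x := by
      have := congrArg (TensorProduct.rid k A) (lTensor_counit_comul (R := k) x)
      rwa [TensorProduct.rid_tmul, one_smul] at this
    have hfx := h.map f
    rw [map_sub, hf] at hfx
    simpa [f, h𝒜.counit_eq_zero n hn u hu] using hfx
  have hu' : IsNilpotent ((1 : A) ⊗ₜ[k] (x - u)) :=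
    hxu.map (Algebra.TensorProduct.includeRight : A →ₐ[k] A ⊗[k] A)
  have hv' : IsNilpotent ((x - v) ⊗ₜ[k] (1 : A)) :=
    hxv.map (Algebra.TensorProduct.includeLeft : A →ₐ[k] A ⊗[k] A)
  convert (Commute.all _ _).isNilpotent_sub h ((Commute.all _ _).isNilpotent_add hu' hv') using 1
  · rfl
  rw [TensorProduct.tmul_sub, TensorProduct.sub_tmul]
  abel

/-- In a connected graded commutative bialgebra over a field of characteristic `p > 0`,
if `x` is homogeneous of degree `n > 0` and every homogeneous element of degree `m` with
`0 < m < n` is nilpotent, then some `p`-th power iterate `x^(p^N)` of `x` is primitive. -/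
theorem exists_pow_pow_char_primitive
    {k : Type*} [Field k] {A : Type*} [CommRing A] [Bialgebra k A]
    (p : ℕ) (hp : 0 < p) [CharP k p]
    (𝒜 : ℕ → Submodule k A) (h𝒜 : IsConnGradedBialgebra k A 𝒜)
    (n : ℕ) (hn : 0 < n) (x : A) (hx : x ∈ 𝒜 n)
    (hnil : ∀ m : ℕ, 0 < m → m < n → ∀ y ∈ 𝒜 m, IsNilpotent y) :
    ∃ N : ℕ, comul (R := k) (x ^ p ^ N) =
      (1 : A) ⊗ₜ[k] (x ^ p ^ N) + (x ^ p ^ N) ⊗ₜ[k] (1 : A) := by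
  obtain ⟨N, hN⟩ := h𝒜.isNilpotent_comul_sub hn hx hnil
  have : NeZero p := ⟨hp.ne'⟩
  have : Fact p.Prime := CharP.char_is_prime_of_pos k p
  cases subsingleton_or_nontrivial (A ⊗[k] A) with
  | inl _ => exact ⟨0, Subsingleton.elim _ _⟩
  | inr _ =>
    have : CharP (A ⊗[k] A) p :=
      charP_of_injective_algebraMap (algebraMap k (A ⊗[k] A)).injective p
    have h : (comul (R := k) x - ((1 : A) ⊗ₜ[k] x + x ⊗ₜ[k] (1 : A))) ^ p ^ N = 0 :=
      pow_eq_zero_of_le (Nat.lt_pow_self (Nat.Prime.one_lt Fact.out)).le hN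
    rw [sub_pow_char_pow, add_pow_char_pow, sub_eq_zero] at h
    refine ⟨N, ?_⟩
    rw [Bialgebra.comul_pow, h]
    simp
end

section
/- Let A and B be connected graded bialgebras over a field k, and let f : A → B be a k-algebra homomorphism that is also a coalgebra map ((f ⊗ f) ∘ Δ_A = Δ_B ∘ f and ε_B ∘ f = ε_A) and preserves the gradings (f maps 𝒜 n into ℬ n for all n). Let n > 0 and let a ∈ 𝒜 n be a nonzero element with f(a) = 0, and suppose ker f ∩ 𝒜 m = 0 for all m with 0 < m < n (so a has minimal positive degree in the kernel of f). Then a is primitive: Δ_A a = 1 ⊗ a + a ⊗ 1. -/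
open TensorProduct Coalgebra

namespace IsConnGradedBialgebra

variable {k : Type*} [CommSemiring k] {A : Type*} [Semiring A] [Bialgebra k A]
  {𝒜 : ℕ → Submodule k A}

/-- The counit vanishes on the sum of the components in degrees strictly between `0` and `n`. -/
lemma counit_comp_subtype_eq_zero (h : IsConnGradedBialgebra k A 𝒜) (n : ℕ) :
    counit (R := k) (A := A) ∘ₗ (⨆ i ∈ Finset.Ioo 0 n, 𝒜 i).subtype = 0 := by
  have hle : (⨆ i ∈ Finset.Ioo 0 n, 𝒜 i) ≤ LinearMap.ker (counit (R := k) (A := A)) :=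
    iSup₂_le fun i hi x hx ↦ h.counit_eq_zero i (Finset.mem_Ioo.1 hi).1 x hx
  ext x
  exact hle x.2

/-- A tensor of total degree `n > 0` splits into its components of bidegree `(0, n)` and `(n, 0)`
and a part whose tensor factors have degree strictly between `0` and `n`. -/
lemma exists_eq_of_mem_span (h : IsConnGradedBialgebra k A 𝒜) {n : ℕ} (hn : 0 < n)
    {t : A ⊗[k] A} (ht : t ∈ Submodule.span k {t : A ⊗[k] A |
      ∃ i j : ℕ, i + j = n ∧ ∃ a ∈ 𝒜 i, ∃ b ∈ 𝒜 j, t = a ⊗ₜ[k] b}) :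
    ∃ b ∈ 𝒜 n, ∃ c ∈ 𝒜 n, ∃ q : ↥(⨆ i ∈ Finset.Ioo 0 n, 𝒜 i) ⊗[k] ↥(⨆ i ∈ Finset.Ioo 0 n, 𝒜 i),
      t = (1 : A) ⊗ₜ[k] b + c ⊗ₜ[k] (1 : A) + mapIncl _ _ q := by
  induction ht using Submodule.span_induction with
  | mem t ht =>
    obtain ⟨i, j, hij, a, ha, b, hb, rfl⟩ := ht
    rcases Nat.eq_zero_or_pos i with rfl | hi
    · obtain rfl : j = n := by omega
      rw [h.connected, Submodule.mem_one] at ha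
      obtain ⟨r, rfl⟩ := ha
      refine ⟨r • b, Submodule.smul_mem _ _ hb, 0, zero_mem _, 0, ?_⟩
      simp [Algebra.algebraMap_eq_smul_one, smul_tmul]
    rcases Nat.eq_zero_or_pos j with rfl | hj
    · obtain rfl : i = n := by omega
      rw [h.connected, Submodule.mem_one] at hb
      obtain ⟨r, rfl⟩ := hb
      refine ⟨0, zero_mem _, r • a, Submodule.smul_mem _ _ ha, 0, ?_⟩
      simp [Algebra.algebraMap_eq_smul_one, smul_tmul]
    have mem {l : ℕ} (hl : 0 < l) (hln : l < n) {x : A} (hx : x ∈ 𝒜 l) :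
        x ∈ ⨆ i ∈ Finset.Ioo 0 n, 𝒜 i :=
      Submodule.mem_iSup_of_mem l (Submodule.mem_iSup_of_mem (Finset.mem_Ioo.2 ⟨hl, hln⟩) hx)
    refine ⟨0, zero_mem _, 0, zero_mem _,
      ⟨a, mem hi (by omega) ha⟩ ⊗ₜ[k] ⟨b, mem hj (by omega) hb⟩, ?_⟩
    simp [mapIncl]
  | zero => exact ⟨0, zero_mem _, 0, zero_mem _, 0, by simp⟩
  | add s t _ _ hs ht =>
    obtain ⟨b, hb, c, hc, q, rfl⟩ := hs
    obtain ⟨b', hb', c', hc', q', rfl⟩ := ht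
    refine ⟨b + b', add_mem hb hb', c + c', add_mem hc hc', q + q', ?_⟩
    rw [tmul_add, add_tmul, map_add]
    abel
  | smul r t _ ht =>
    obtain ⟨b, hb, c, hc, q, rfl⟩ := ht
    refine ⟨r • b, Submodule.smul_mem _ _ hb, r • c, Submodule.smul_mem _ _ hc, r • q, ?_⟩
    rw [tmul_smul, ← smul_tmul', map_smul, smul_add, smul_add]

/-- In a connected graded bialgebra, the comultiplication of an element of degree `n > 0` is
`1 ⊗ x + x ⊗ 1` up to tensors whose factors have degree strictly between `0` and `n`. -/
lemma exists_comul_eq (h : IsConnGradedBialgebra k A 𝒜) {n : ℕ} (hn : 0 < n) {x : A}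
    (hx : x ∈ 𝒜 n) :
    ∃ q : ↥(⨆ i ∈ Finset.Ioo 0 n, 𝒜 i) ⊗[k] ↥(⨆ i ∈ Finset.Ioo 0 n, 𝒜 i),
      comul (R := k) x = (1 : A) ⊗ₜ[k] x + x ⊗ₜ[k] (1 : A) + mapIncl _ _ q := by
  obtain ⟨b, hb, c, hc, q, hq⟩ := h.exists_eq_of_mem_span hn (h.comul_mem n x hx)
  have hr : counit.rTensor A (mapIncl _ _ q) = (0 : k ⊗[k] A) := by
    rw [mapIncl, LinearMap.rTensor, ← LinearMap.comp_apply, ← map_comp,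
      h.counit_comp_subtype_eq_zero, map_zero_left, LinearMap.zero_apply]
  have hl : counit.lTensor A (mapIncl _ _ q) = (0 : A ⊗[k] k) := by
    rw [mapIncl, LinearMap.lTensor, ← LinearMap.comp_apply, ← map_comp,
      h.counit_comp_subtype_eq_zero, map_zero_right, LinearMap.zero_apply]
  have hxb : x = b := by
    have := rTensor_counit_comul (R := k) x
    rw [hq, map_add, map_add, hr] at this
    simpa [h.counit_eq_zero n hn c hc] using (congrArg (TensorProduct.lid k A) this).symm
  have hxc : x = c := by
    have := lTensor_counit_comul (R := k) x
    rw [hq, map_add, map_add, hl] at this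
    simpa [h.counit_eq_zero n hn b hb] using (congrArg (TensorProduct.rid k A) this).symm
  exact ⟨q, by rw [hq, ← hxb, ← hxc]⟩

end IsConnGradedBialgebra

/-- A graded linear map that is injective on each of finitely many components is injective on
their sum. -/
lemma injective_comp_subtype_iSup_of_graded {ι k M N : Type*} [DecidableEq ι] [Ring k]
    [AddCommGroup M] [AddCommGroup N] [Module k M] [Module k N] {p : ι → Submodule k M}
    {q : ι → Submodule k N} (hq : iSupIndep q) (f : M →ₗ[k] N) (s : Finset ι)
    (hf : ∀ i ∈ s, ∀ x ∈ p i, f x ∈ q i) (hinj : ∀ i ∈ s, ∀ x ∈ p i, f x = 0 → x = 0) :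
    Function.Injective (f ∘ₗ (⨆ i ∈ s, p i).subtype) := by
  rw [injective_iff_map_eq_zero]
  rintro ⟨x, hx⟩ hfx
  obtain ⟨μ, rfl⟩ := (Submodule.mem_iSup_finset_iff_exists_sum _ _).1 hx
  have hsum : ∑ i ∈ s, f (μ i) = 0 := by simpa using hfx
  have hzero := (iSupIndep_iff_finsetSum_eq_zero_imp_eq_zero q).1 hq s (fun i ↦ f (μ i))
    (fun i hi ↦ hf i hi _ (μ i).2) hsum
  exact Subtype.ext (Finset.sum_eq_zero fun i hi ↦ hinj i hi _ (μ i).2 (hzero i hi))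

/-- A minimal-positive-degree homogeneous element of the kernel of a map of connected graded
bialgebras is primitive. -/
theorem primitive_of_minimal_degree_mem_ker
    {k : Type*} [Field k] {A B : Type*} [Ring A] [Ring B] [Bialgebra k A] [Bialgebra k B]
    (𝒜 : ℕ → Submodule k A) (h𝒜 : IsConnGradedBialgebra k A 𝒜)
    (ℬ : ℕ → Submodule k B) (hℬ : IsConnGradedBialgebra k B ℬ)
    (f : A →ₐ[k] B)
    (hf_comul : TensorProduct.map f.toLinearMap f.toLinearMap ∘ₗ comul (R := k) (A := A)
      = comul (R := k) (A := B) ∘ₗ f.toLinearMap)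
    (hf_counit : counit (R := k) (A := B) ∘ₗ f.toLinearMap = counit (R := k) (A := A))
    (hf_graded : ∀ n : ℕ, ∀ x ∈ 𝒜 n, f x ∈ ℬ n)
    (n : ℕ) (hn : 0 < n) (a : A) (ha : a ∈ 𝒜 n) (ha0 : a ≠ 0) (hfa : f a = 0)
    (hmin : ∀ m : ℕ, 0 < m → m < n → ∀ y ∈ 𝒜 m, f y = 0 → y = 0) :
    comul (R := k) a = (1 : A) ⊗ₜ[k] a + a ⊗ₜ[k] (1 : A) := by
  obtain ⟨q, hq⟩ := h𝒜.exists_comul_eq hn ha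
  have hinj := injective_comp_subtype_iSup_of_graded hℬ.internal.submodule_iSupIndep
    f.toLinearMap (Finset.Ioo 0 n) (fun i _ ↦ hf_graded i)
    fun i hi ↦ hmin i (Finset.mem_Ioo.1 hi).1 (Finset.mem_Ioo.1 hi).2
  have hfq := LinearMap.congr_fun hf_comul a
  simp only [LinearMap.comp_apply, hq, map_add, map_tmul, AlgHom.toLinearMap_apply, hfa,
    tmul_zero, zero_tmul, zero_add, map_zero] at hfq
  rw [mapIncl, ← LinearMap.comp_apply, ← map_comp] at hfq
  have hq0 : q = 0 := map_injective_of_flat_flat _ _ hinj hinj (hfq.trans (map_zero _).symm)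
  rw [hq, hq0, map_zero, add_zero]
end

section
/- Let k be a field and R = k[x₀, x₁, x₂, …] the polynomial ring over k in countably infinitely many variables (MvPolynomial ℕ k). Let M be a nonzero R-module that is finite-dimensional as a k-vector space, and suppose there exists K ∈ ℕ such that xᵢ · m = 0 for all i ≥ K and all m ∈ M. Then M is not finitely presented as an R-module. -/
/-- If `X i` occurs in no entry of the vectors of `S`, then the `R`-span of `S` is stable under
the entrywise partial derivative with respect to `X i`. -/
theorem MvPolynomial.pderiv_comp_mem_span {σ ι k : Type*} [CommRing k]
    {S : Set (ι → MvPolynomial σ k)} {i : σ}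
    (hS : ∀ g ∈ S, ∀ j, i ∉ (g j).vars) {v : ι → MvPolynomial σ k}
    (hv : v ∈ Submodule.span (MvPolynomial σ k) S) :
    (fun j => MvPolynomial.pderiv i (v j)) ∈ Submodule.span (MvPolynomial σ k) S := by
  induction hv using Submodule.span_induction with
  | mem g hg =>
    have : (fun j => MvPolynomial.pderiv i (g j)) = 0 := by
      ext1 j
      exact MvPolynomial.pderiv_eq_zero_of_notMem_vars (hS g hg j)
    rw [this]
    exact zero_mem _
  | zero =>
    simp only [Pi.zero_apply, map_zero]
    exact zero_mem _
  | add u w _ _ hu hw =>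
    simp only [Pi.add_apply, map_add]
    exact add_mem hu hw
  | smul r u hu ih =>
    have : (fun j => MvPolynomial.pderiv i ((r • u) j)) =
        r • (fun j => MvPolynomial.pderiv i (u j)) + MvPolynomial.pderiv i r • u := by
      ext1 j
      simp [Derivation.leibniz, mul_comm]
    rw [this]
    exact add_mem (Submodule.smul_mem _ _ ih) (Submodule.smul_mem _ _ hu)


/-- **Example 9.2 (ex:NotBeyondSlope1), key algebraic step.** Let `k` be a field and
`R = k[x₀, x₁, x₂, …]` the polynomial ring in countably many variables. A nonzero
`R`-module `M` which is finite-dimensional over `k` and on which all but finitely many of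
the variables act as zero is not finitely presented as an `R`-module. -/
theorem not_finitePresentation_of_almost_all_variables_act_trivially
    {k : Type*} [Field k] {M : Type*} [AddCommGroup M]
    [Module (MvPolynomial ℕ k) M] [Module k M]
    [IsScalarTower k (MvPolynomial ℕ k) M]
    [Nontrivial M] [FiniteDimensional k M]
    (K : ℕ) (hK : ∀ i : ℕ, K ≤ i → ∀ m : M, (MvPolynomial.X i : MvPolynomial ℕ k) • m = 0) :
    ¬ Module.FinitePresentation (MvPolynomial ℕ k) M := by
  classical
  intro hfp
  obtain ⟨n, _, f, _, hf, _⟩ :=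
    Module.FinitePresentation.exists_fin' (MvPolynomial ℕ k) M
  obtain ⟨S, hS⟩ := Module.FinitePresentation.fg_ker f hf
  obtain ⟨i, hi⟩ := Infinite.exists_notMem_finset
    (Finset.range K ∪ S.biUnion fun g => Finset.univ.biUnion fun j => (g j).vars)
  simp only [Finset.mem_union, Finset.mem_range, Finset.mem_biUnion, Finset.mem_univ, true_and,
    not_or, not_lt, not_exists, not_and] at hi
  have hX (v : Fin n → MvPolynomial ℕ k) :
      (MvPolynomial.X i : MvPolynomial ℕ k) • v ∈ LinearMap.ker f := by
    rw [LinearMap.mem_ker, map_smul, hK i hi.1]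
  have hker (v : Fin n → MvPolynomial ℕ k) : v ∈ LinearMap.ker f := by
    have hD := hX v
    rw [← hS] at hD
    replace hD := MvPolynomial.pderiv_comp_mem_span (fun g hg j => hi.2 g hg j) hD
    rw [hS] at hD
    have hv : v = (fun j => MvPolynomial.pderiv i
          (((MvPolynomial.X i : MvPolynomial ℕ k) • v) j)) -
        (MvPolynomial.X i : MvPolynomial ℕ k) • fun j => MvPolynomial.pderiv i (v j) := by
      ext1 j
      simp [Derivation.leibniz]
    rw [hv]
    exact sub_mem hD (hX _)
  obtain ⟨m, hm⟩ := exists_ne (0 : M)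
  obtain ⟨v, rfl⟩ := hf m
  exact hm (hker v)
end

section
/- Let N ≥ 1 and let R = ℚ[r, b] be the polynomial ring in two variables over ℚ. Let d : R^{N+1} → R^{N} be the R-linear map defined on standard bases (e₁, …, e_{N+1}) and (f₁, …, f_N) by d(e₁) = r·f₁, d(e_j) = r·f_j − b·f_{j−1} for 2 ≤ j ≤ N, and d(e_{N+1}) = −b·f_N. Then the kernel of d is the free rank-one submodule generated by v = Σ_{j=1}^{N+1} b^{N+1−j} r^{j−1} e_j; that is, ker d = R·v and the annihilator of v is zero. -/
open MvPolynomial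

/-- The polynomial ring `ℚ[r, b]`, with `r = X 0` and `b = X 1`. -/
noncomputable abbrev RQ : Type := MvPolynomial (Fin 2) ℚ

/-- In a domain, if `b` is prime and does not divide `r`, then any finite sequence with
`r * x i = b * x (i + 1)` is a multiple of the geometric sequence `b ^ (n - i) * r ^ i`. -/
theorem exists_eq_mul_pow_mul_pow_of_prime {R : Type*} [CommRing R] [IsDomain R] {r b : R}
    (hb : Prime b) (hbr : ¬ b ∣ r) (x : ℕ → R) (n : ℕ)
    (hx : ∀ i < n, r * x i = b * x (i + 1)) :
    ∃ c, ∀ i ≤ n, x i = c * (b ^ (n - i) * r ^ i) := by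
  induction n with
  | zero => exact ⟨x 0, fun i hi => by simp [Nat.le_zero.mp hi]⟩
  | succ n ih =>
    obtain ⟨c, hc⟩ := ih fun i hi => hx i (by omega)
    have hn : c * r ^ (n + 1) = b * x (n + 1) := by
      rw [← hx n n.lt_succ_self, hc n le_rfl, Nat.sub_self]
      ring
    obtain ⟨c', rfl⟩ : b ∣ c :=
      (hb.dvd_or_dvd ⟨_, hn⟩).resolve_right fun h => hbr (hb.dvd_of_dvd_pow h)
    refine ⟨c', fun i hi => ?_⟩
    rcases hi.eq_or_lt with rfl | hi
    · apply mul_left_cancel₀ hb.ne_zero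
      rw [← hn, Nat.sub_self]
      ring
    · rw [hc i (by omega), Nat.succ_sub (by omega : i ≤ n), pow_succ]
      ring

/-- A linear map given on the standard basis by a bidiagonal matrix with constant diagonals. -/
theorem apply_eq_of_bidiagonal {R : Type*} [CommRing R] {r b : R} {N : ℕ}
    (d : (Fin (N + 1) → R) →ₗ[R] (Fin N → R))
    (hd : ∀ j : Fin (N + 1), d (Pi.single j 1) = fun i : Fin N =>
      (if (j : ℕ) = (i : ℕ) then r else 0) - (if (j : ℕ) = (i : ℕ) + 1 then b else 0))
    (x : Fin (N + 1) → R) (i : Fin N) :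
    d x i = r * x i.castSucc - b * x i.succ := by
  have h₁ (j : Fin (N + 1)) : (j : ℕ) = (i : ℕ) ↔ j = i.castSucc := by simp [Fin.ext_iff]
  have h₂ (j : Fin (N + 1)) : (j : ℕ) = (i : ℕ) + 1 ↔ j = i.succ := by simp [Fin.ext_iff]
  have hs (j : Fin (N + 1)) : (fun k => if j = k then (1 : R) else 0) = Pi.single j 1 := by
    ext k
    simp [Pi.single_apply, eq_comm]
  rw [LinearMap.pi_apply_eq_sum_univ d x]
  simp only [hs, hd, Finset.sum_apply, Pi.smul_apply, smul_eq_mul, h₁, h₂, mul_sub,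
    Finset.sum_sub_distrib, mul_ite, mul_zero, Finset.sum_ite_eq', Finset.mem_univ, if_true]
  ring

/-- **Example 9.1 (ex:MVConnectingMap), kernel computation.** Over `R = ℚ[r,b]`, let
`d : R^{N+1} → R^N` be the `R`-linear map with `d(e₁) = r·f₁`, `d(e_j) = r·f_j − b·f_{j−1}`
for `2 ≤ j ≤ N`, and `d(e_{N+1}) = −b·f_N` (here written with `0`-indexed bases).  Then
`ker d` is the free rank-one submodule generated by `v = Σ_{j=1}^{N+1} b^{N+1−j} r^{j−1} e_j`:
we have `ker d = R·v` and the annihilator of `v` is zero. -/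
theorem ker_connecting_map_eq_span_singleton (N : ℕ) (hN : 1 ≤ N)
    (d : (Fin (N + 1) → RQ) →ₗ[RQ] (Fin N → RQ))
    (hd : ∀ j : Fin (N + 1), d (Pi.single j 1) = fun i : Fin N =>
      (if (j : ℕ) = (i : ℕ) then X 0 else 0) - (if (j : ℕ) = (i : ℕ) + 1 then X 1 else 0))
    (v : Fin (N + 1) → RQ)
    (hv : v = fun j : Fin (N + 1) => X 1 ^ (N - (j : ℕ)) * X 0 ^ (j : ℕ)) :
    LinearMap.ker d = Submodule.span RQ {v} ∧ ∀ c : RQ, c • v = 0 → c = 0 := by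
  subst hv
  have hb : Prime (X 1 : RQ) := X_prime
  have hbr : ¬ (X 1 : RQ) ∣ X 0 := by simp [X_dvd_X]
  refine ⟨?_, fun c hc => ?_⟩
  · ext x
    rw [LinearMap.mem_ker, Submodule.mem_span_singleton, _root_.funext_iff]
    simp only [apply_eq_of_bidiagonal d hd, Pi.zero_apply, sub_eq_zero]
    constructor
    · intro h
      obtain ⟨c, hc⟩ := exists_eq_mul_pow_mul_pow_of_prime hb hbr
        (fun i => if hi : i < N + 1 then x ⟨i, hi⟩ else 0) N fun i hi => by
          simpa [hi, Nat.lt_succ_of_lt hi] using h ⟨i, hi⟩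
      refine ⟨c, funext fun j => ?_⟩
      simpa [Nat.le_of_lt_succ j.isLt] using (hc j (Nat.le_of_lt_succ j.isLt)).symm
    · rintro ⟨c, rfl⟩ i
      obtain ⟨k, hk⟩ := Nat.exists_eq_add_of_lt i.isLt
      have h₁ : N - (i : ℕ) = k + 1 := by omega
      have h₂ : N - ((i : ℕ) + 1) = k := by omega
      simp only [Pi.smul_apply, smul_eq_mul, Fin.val_castSucc, Fin.val_succ, h₁, h₂]
      ring
  · simpa [hb.ne_zero] using congrFun hc 0
end

section
/- Let N ≥ 1 and let R = ℚ[r, b] be the polynomial ring in two variables over ℚ. Let M_N be the quotient of the free R-module on x₁, …, x_N by the submodule generated by the elements r·x₁, r·x_j − b·x_{j−1} for 2 ≤ j ≤ N, and b·x_N. Then the image of b^{N−1}·x₁ in M_N is nonzero. -/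
open MvPolynomial

/-- The `j`-th standard basis vector `x_{j+1}` of the free module `R^N` (0-indexed). -/
noncomputable def stdVec (N : ℕ) (j : ℕ) : Fin N → RQ :=
  fun i => if (i : ℕ) = j then 1 else 0

/-- The relations `r·x₁`, `r·x_j − b·x_{j−1}` (for `2 ≤ j ≤ N`), and `b·x_N`,
written with 0-indexed basis vectors. -/
noncomputable def relSet (N : ℕ) : Set (Fin N → RQ) :=
  {(X 0 : RQ) • stdVec N 0, (X 1 : RQ) • stdVec N (N - 1)} ∪
    {w | ∃ j : ℕ, 1 ≤ j ∧ j < N ∧ w = (X 0 : RQ) • stdVec N j - (X 1 : RQ) • stdVec N (j - 1)}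

/-- The functional `R^N → R` sending the `i`-th basis vector (0-indexed) to `r^{N-1-i} b^i`. -/
noncomputable def monomialMap (N : ℕ) : (Fin N → RQ) →ₗ[RQ] RQ :=
  Fintype.linearCombination RQ fun i : Fin N => (X 0 : RQ) ^ (N - 1 - (i : ℕ)) * X 1 ^ (i : ℕ)

theorem monomialMap_stdVec {N j : ℕ} (hj : j < N) :
    monomialMap N (stdVec N j) = X 0 ^ (N - 1 - j) * X 1 ^ j := by
  rw [monomialMap, Fintype.linearCombination_apply, Finset.sum_eq_single ⟨j, hj⟩]
  · simp [stdVec]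
  · intro i _ hi
    have : (i : ℕ) ≠ j := fun h => hi (Fin.ext h)
    simp [stdVec, this]
  · simp

theorem span_relSet_le_comap {N : ℕ} (hN : 1 ≤ N) :
    Submodule.span RQ (relSet N) ≤
      Submodule.comap (monomialMap N) (Ideal.span {(X 0 : RQ) ^ N, X 1 ^ N}) := by
  obtain ⟨n, rfl⟩ : ∃ n, N = n + 1 := ⟨N - 1, by omega⟩
  rw [Submodule.span_le]
  rintro w ((rfl | rfl) | ⟨j, h1, hj, rfl⟩) <;>
    simp only [SetLike.mem_coe, Submodule.mem_comap, map_sub, map_smul, smul_eq_mul]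
  · rw [monomialMap_stdVec n.succ_pos]
    refine Ideal.subset_span (Or.inl ?_)
    simp [pow_succ']
  · rw [monomialMap_stdVec (by omega)]
    refine Ideal.subset_span (Or.inr ?_)
    simp [pow_succ']
  · rw [monomialMap_stdVec hj, monomialMap_stdVec (by omega)]
    obtain ⟨k, rfl⟩ : ∃ k, j = k + 1 := ⟨j - 1, by omega⟩
    obtain ⟨l, rfl⟩ : ∃ l, n = k + 1 + l := ⟨n - (k + 1), by omega⟩
    have h : k + 1 + l + 1 - 1 - (k + 1) = l := by omega
    have h' : k + 1 + l + 1 - 1 - (k + 1 - 1) = l + 1 := by omega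
    rw [h, h', Nat.add_sub_cancel]
    convert Ideal.zero_mem _ using 1
    ring

theorem pow_mul_pow_notMem_span (n : ℕ) :
    (X 0 : RQ) ^ n * X 1 ^ n ∉ Ideal.span {(X 0 : RQ) ^ (n + 1), X 1 ^ (n + 1)} := by
  intro h
  obtain ⟨a, c, h⟩ := Ideal.mem_span_pair.1 h
  have := congrArg (coeff (Finsupp.single 0 n + Finsupp.single 1 n)) h
  simp [X_pow_eq_monomial, coeff_mul_monomial', monomial_mul, Finsupp.le_def,
    Fin.forall_fin_two] at this

/-- **Example 9.1 (ex:MVConnectingMap), nontriviality of the connecting class.** In the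
module `M_N = R^N / (r·x₁, r·x_j − b·x_{j−1} (2 ≤ j ≤ N), b·x_N)` over `R = ℚ[r,b]`, the
image of `b^{N−1}·x₁` is nonzero. -/
theorem mk_pow_smul_ne_zero (N : ℕ) (hN : 1 ≤ N) :
    (Submodule.Quotient.mk ((X 1 : RQ) ^ (N - 1) • stdVec N 0) :
      (Fin N → RQ) ⧸ Submodule.span RQ (relSet N)) ≠ 0 := by
  rw [Ne, Submodule.Quotient.mk_eq_zero]
  intro h
  have hmem := span_relSet_le_comap hN h
  obtain ⟨n, rfl⟩ : ∃ n, N = n + 1 := ⟨N - 1, by omega⟩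
  rw [Submodule.mem_comap, map_smul, monomialMap_stdVec n.succ_pos] at hmem
  refine pow_mul_pow_notMem_span n ?_
  simpa [mul_comm] using hmem
end

section
/- Let N ≥ 1 and let R = ℚ[r, b] be the polynomial ring in two variables over ℚ. Let M_N be the quotient of the free R-module on x₁, …, x_N by the submodule generated by r·x₁, r·x_j − b·x_{j−1} for 2 ≤ j ≤ N, and b·x_N, and let ℚ be the R-module given by the augmentation r, b ↦ 0. Then Tor₂^R(M_N, ℚ) is a one-dimensional ℚ-vector space; in particular it is nonzero. -/
open MvPolynomial CategoryTheory

/-- The module `M_N = R^N / (r·x₁, r·x_j − b·x_{j−1} (2 ≤ j ≤ N), b·x_N)`. -/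
noncomputable abbrev MN (N : ℕ) : Type :=
  (Fin N → RQ) ⧸ Submodule.span RQ (relSet N)

/-- `ℚ`, regarded as an `R = ℚ[r,b]`-module via the augmentation `r, b ↦ 0`. -/
def QAug : Type := ℚ

noncomputable instance : AddCommGroup QAug := inferInstanceAs (AddCommGroup ℚ)

noncomputable instance : Module RQ QAug :=
  Module.compHom ℚ ((aeval (fun _ : Fin 2 => (0 : ℚ))).toRingHom : RQ →+* ℚ)

/-- The `R`-module `Tor₂^R(M_N, ℚ)`. -/
noncomputable def torTwo (N : ℕ) : ModuleCat RQ :=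
  ((Tor (ModuleCat RQ) 2).obj (ModuleCat.of RQ (MN N))).obj (ModuleCat.of RQ QAug)

/-- The presentation map `R^{N+1} → R^N` whose image is the submodule of relations of `M_N`. -/
noncomputable def relMap (N : ℕ) : (Fin (N + 1) → RQ) →ₗ[RQ] (Fin N → RQ) :=
  LinearMap.pi fun j =>
    (X 0 : RQ) • LinearMap.proj j.castSucc - (X 1 : RQ) • LinearMap.proj j.succ

lemma relMap_apply (N : ℕ) (e : Fin (N + 1) → RQ) (j : Fin N) :
    relMap N e j = X 0 * e j.castSucc - X 1 * e j.succ := rfl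

lemma relMap_stdVec_zero (N : ℕ) :
    relMap N (stdVec (N + 1) 0) = (X 0 : RQ) • stdVec N 0 := by
  ext1 j
  simp [relMap_apply, stdVec]

lemma relMap_stdVec_succ (N k : ℕ) :
    relMap N (stdVec (N + 1) (k + 1)) =
      (X 0 : RQ) • stdVec N (k + 1) - (X 1 : RQ) • stdVec N k := by
  ext1 j
  simp [relMap_apply, stdVec]

lemma stdVec_self (N : ℕ) : stdVec N N = 0 := by
  ext1 j
  simp [stdVec, j.isLt.ne]

lemma eq_sum_smul_stdVec (N : ℕ) (e : Fin N → RQ) : e = ∑ k, e k • stdVec N k := by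
  ext1 j
  simp [stdVec, Finset.sum_apply, Fin.val_inj]

lemma span_relSet_eq_range (N : ℕ) (hN : 1 ≤ N) :
    Submodule.span RQ (relSet N) = LinearMap.range (relMap N) := by
  obtain ⟨n, rfl⟩ : ∃ n, N = n + 1 := ⟨N - 1, by omega⟩
  apply le_antisymm
  · rw [Submodule.span_le]
    rintro w ((rfl | rfl) | ⟨j, hj, -, rfl⟩)
    · exact ⟨_, relMap_stdVec_zero _⟩
    · refine ⟨-stdVec (n + 2) (n + 1), ?_⟩
      rw [map_neg, relMap_stdVec_succ, stdVec_self]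
      simp
    · obtain ⟨k, rfl⟩ : ∃ k, j = k + 1 := ⟨j - 1, by omega⟩
      exact ⟨_, relMap_stdVec_succ _ _⟩
  · rintro _ ⟨e, rfl⟩
    rw [eq_sum_smul_stdVec _ e, map_sum]
    refine Submodule.sum_mem _ fun k _ => ?_
    rw [map_smul]
    refine Submodule.smul_mem _ _ ?_
    obtain ⟨k, hk⟩ := k
    rcases k with _ | k
    · rw [relMap_stdVec_zero]
      exact Submodule.subset_span (.inl (.inl rfl))
    · rw [relMap_stdVec_succ]
      obtain rfl | hkn := eq_or_ne k n
      · rw [stdVec_self, smul_zero, zero_sub]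
        exact Submodule.neg_mem _ (Submodule.subset_span (.inl (.inr rfl)))
      · exact Submodule.subset_span (.inr ⟨k + 1, by omega, by omega, rfl⟩)

/-- The generator `(b^N, r b^{N-1}, …, r^N)` of the kernel of `relMap N`. -/
noncomputable def syzygy (N : ℕ) : Fin (N + 1) → RQ :=
  fun j => X 0 ^ (j : ℕ) * X 1 ^ (N - j)

lemma pow_mul_eq_of_relMap_eq_zero {N : ℕ} {e : Fin (N + 1) → RQ} (he : relMap N e = 0)
    (k : ℕ) (hk : k < N + 1) : (X 1 : RQ) ^ k * e ⟨k, hk⟩ = X 0 ^ k * e 0 := by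
  induction k with
  | zero => simp
  | succ k ih =>
    have h : X 0 * e ⟨k, by omega⟩ - X 1 * e ⟨k + 1, hk⟩ = 0 := congrFun he ⟨k, by omega⟩
    linear_combination X 0 * ih (by omega) - X 1 ^ k * h

lemma not_X_one_dvd_X_zero_pow (n : ℕ) : ¬ (X 1 : RQ) ∣ X 0 ^ n := fun h => by
  have h := X_dvd_X.1 ((X_prime (R := ℚ) (i := (1 : Fin 2))).dvd_of_dvd_pow h)
  simp at h

lemma exists_eq_smul_syzygy {N : ℕ} {e : Fin (N + 1) → RQ} (he : relMap N e = 0) :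
    ∃ c : RQ, e = c • syzygy N := by
  obtain ⟨c, hc⟩ : (X 1 : RQ) ^ N ∣ e 0 :=
    (X_prime (R := ℚ) (i := (1 : Fin 2))).pow_dvd_of_dvd_mul_left N (not_X_one_dvd_X_zero_pow N)
      ⟨_, (pow_mul_eq_of_relMap_eq_zero he N (by omega)).symm⟩
  refine ⟨c, funext fun ⟨k, hk⟩ => ?_⟩
  refine mul_left_cancel₀ (pow_ne_zero k (X_ne_zero (R := ℚ) (1 : Fin 2))) ?_
  have hpow : (X 1 : RQ) ^ N = X 1 ^ k * X 1 ^ (N - k) := by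
    rw [← pow_add]; congr 1; omega
  rw [pow_mul_eq_of_relMap_eq_zero he, hc, hpow]
  simp only [syzygy, Pi.smul_apply, smul_eq_mul]
  ring

lemma relMap_syzygy (N : ℕ) : relMap N (syzygy N) = 0 := by
  ext1 j
  have h : N - (j : ℕ) = (N - (j + 1)) + 1 := by omega
  simp only [relMap_apply, syzygy, Fin.val_castSucc, Fin.val_succ, h, Pi.zero_apply]
  ring

/-- The socle of an `R`-module: the elements killed by `r` and `b`. -/
noncomputable def socle (M : Type*) [AddCommGroup M] [Module RQ M] : Submodule RQ M :=
  LinearMap.ker (LinearMap.lsmul RQ M (X 0)) ⊓ LinearMap.ker (LinearMap.lsmul RQ M (X 1))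

lemma mem_socle {M : Type*} [AddCommGroup M] [Module RQ M] {m : M} :
    m ∈ socle M ↔ (X 0 : RQ) • m = 0 ∧ (X 1 : RQ) • m = 0 := Iff.rfl

/-- The vector `(b^n, r b^{n-1}, …, r^n, 0)`, whose `b`-multiple agrees with `syzygy (n + 1)` except
in the last coordinate. -/
noncomputable def syzygyQuot (n : ℕ) : Fin (n + 2) → RQ :=
  fun j => if (j : ℕ) = n + 1 then 0 else X 0 ^ (j : ℕ) * X 1 ^ (n - j)

lemma X_one_smul_syzygyQuot_add (n : ℕ) :
    (X 1 : RQ) • syzygyQuot n + (X 0 : RQ) • ((X 0 : RQ) ^ n • stdVec (n + 2) (n + 1))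
      = syzygy (n + 1) := by
  ext1 j
  simp only [Pi.add_apply, Pi.smul_apply, smul_eq_mul, syzygyQuot, stdVec, syzygy]
  split_ifs with h
  · rw [h]; simp [pow_succ']
  · have h' : n + 1 - (j : ℕ) = (n - j) + 1 := by omega
    rw [h']; ring

/-- The socle element `r^n x_{n+1}` of `M_{n+1}`, lifted to the free module. -/
noncomputable def socleGen (n : ℕ) : Fin (n + 1) → RQ := (X 0 : RQ) ^ n • stdVec (n + 1) n

lemma relMap_neg_smul_stdVec_last (n : ℕ) :
    relMap (n + 1) (-((X 0 : RQ) ^ n • stdVec (n + 2) (n + 1))) =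
      (X 1 : RQ) • socleGen n := by
  rw [map_neg, map_smul, relMap_stdVec_succ, stdVec_self, socleGen, smul_zero, zero_sub,
    smul_neg, neg_neg, smul_comm]

lemma relMap_syzygyQuot (n : ℕ) :
    relMap (n + 1) (syzygyQuot n) = (X 0 : RQ) • socleGen n := by
  have h := congrArg (relMap (n + 1)) (X_one_smul_syzygyQuot_add n)
  rw [relMap_syzygy, map_add, map_smul, map_smul, ← neg_neg ((X 0 : RQ) ^ n • stdVec (n + 2) (n + 1)),
    map_neg (relMap (n + 1)), relMap_neg_smul_stdVec_last, smul_neg, add_neg_eq_zero,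
    smul_comm] at h
  exact smul_right_injective _ (X_ne_zero (R := ℚ) (1 : Fin 2)) h

lemma syzygy_ne_zero (N : ℕ) : syzygy N ≠ 0 := fun h =>
  pow_ne_zero N (X_ne_zero (R := ℚ) (1 : Fin 2)) (by simpa [syzygy] using congrFun h 0)

lemma socleGen_notMem_range (n : ℕ) : socleGen n ∉ LinearMap.range (relMap (n + 1)) := by
  rintro ⟨z, hz⟩
  obtain ⟨p, hp⟩ := exists_eq_smul_syzygy (N := n + 1) (e := syzygyQuot n - (X 0 : RQ) • z)
    (by rw [map_sub, map_smul, hz, relMap_syzygyQuot, sub_self])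
  obtain ⟨q, hq⟩ := exists_eq_smul_syzygy (N := n + 1)
    (e := -((X 0 : RQ) ^ n • stdVec (n + 2) (n + 1)) - (X 1 : RQ) • z)
    (by rw [map_sub, map_smul, hz, relMap_neg_smul_stdVec_last, sub_self])
  have h : (X 1 * p - X 0 * q : RQ) • syzygy (n + 1) = (1 : RQ) • syzygy (n + 1) := by
    rw [sub_smul, mul_smul, mul_smul, ← hp, ← hq, one_smul, ← X_one_smul_syzygyQuot_add]
    module
  have h := congrArg constantCoeff (smul_left_injective _ (syzygy_ne_zero (n + 1)) h)
  simp at h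

lemma exists_eq_C_add (c : RQ) : ∃ (γ : ℚ) (p q : RQ), c = C γ + X 1 * p + X 0 * q := by
  induction c using MvPolynomial.induction_on with
  | C a => exact ⟨a, 0, 0, by simp⟩
  | add f g hf hg =>
    obtain ⟨γ, p, q, rfl⟩ := hf
    obtain ⟨γ', p', q', rfl⟩ := hg
    exact ⟨γ + γ', p + p', q + q', by rw [C_add]; ring⟩
  | mul_X f i _ =>
    fin_cases i
    · exact ⟨0, 0, f, by simp [mul_comm]⟩
    · exact ⟨0, f, 0, by simp [mul_comm]⟩

lemma exists_eq_X_zero_smul_of_X_one_smul_eq {ι : Type*} {s t : ι → RQ}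
    (h : (X 1 : RQ) • s = (X 0 : RQ) • t) : ∃ z : ι → RQ, s = (X 0 : RQ) • z := by
  have hdvd (i : ι) : (X 0 : RQ) ∣ s i := by
    have h01 : ¬ (X 0 : RQ) ∣ X 1 := by simp [X_dvd_X]
    exact ((X_prime (R := ℚ) (i := (0 : Fin 2))).dvd_or_dvd ⟨t i, congrFun h i⟩).resolve_left h01
  choose z hz using hdvd
  exact ⟨z, funext hz⟩

lemma exists_sub_C_smul_socleGen_mem_range {n : ℕ} {w : Fin (n + 1) → RQ}
    (h0 : (X 0 : RQ) • w ∈ LinearMap.range (relMap (n + 1)))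
    (h1 : (X 1 : RQ) • w ∈ LinearMap.range (relMap (n + 1))) :
    ∃ γ : ℚ, w - (C γ : RQ) • socleGen n ∈ LinearMap.range (relMap (n + 1)) := by
  obtain ⟨u, hu⟩ := h0
  obtain ⟨u', hu'⟩ := h1
  obtain ⟨c, hc⟩ := exists_eq_smul_syzygy (N := n + 1) (e := (X 1 : RQ) • u - (X 0 : RQ) • u')
    (by rw [map_sub, map_smul, map_smul, hu, hu', smul_comm, sub_self])
  obtain ⟨γ, p, q, rfl⟩ := exists_eq_C_add c
  have key : (X 1 : RQ) • (u - (C γ : RQ) • syzygyQuot n - p • syzygy (n + 1)) =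
      (X 0 : RQ) • (u' + (C γ : RQ) • ((X 0 : RQ) ^ n • stdVec (n + 2) (n + 1))
        + q • syzygy (n + 1)) := by
    rw [← sub_eq_zero]
    have hv := congrArg (fun v => (C γ : RQ) • v) (X_one_smul_syzygyQuot_add n)
    linear_combination (norm := module) hc - hv
  obtain ⟨z, hz⟩ := exists_eq_X_zero_smul_of_X_one_smul_eq key
  refine ⟨γ, z, ?_⟩
  refine smul_right_injective _ (X_ne_zero (R := ℚ) (0 : Fin 2)) ?_
  simp only
  rw [← map_smul, ← hz, map_sub, map_sub, map_smul, map_smul, hu, relMap_syzygyQuot,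
    relMap_syzygy, smul_zero, sub_zero, smul_sub, smul_comm]

lemma exists_socle_generator (N : ℕ) (hN : 1 ≤ N) :
    ∃ m : socle (MN N), m ≠ 0 ∧ ∀ m' : socle (MN N), ∃ γ : ℚ, (C γ : RQ) • m = m' := by
  have hspan := span_relSet_eq_range N hN
  obtain ⟨n, rfl⟩ : ∃ n, N = n + 1 := ⟨N - 1, by omega⟩
  have hmk (w : Fin (n + 1) → RQ) : (Submodule.Quotient.mk w : MN (n + 1)) = 0 ↔
      w ∈ LinearMap.range (relMap (n + 1)) := by
    rw [Submodule.Quotient.mk_eq_zero, hspan]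
  refine ⟨⟨Submodule.Quotient.mk (socleGen n), mem_socle.2 ⟨?_, ?_⟩⟩, ?_, ?_⟩
  · rw [← Submodule.Quotient.mk_smul, hmk]
    exact ⟨_, relMap_syzygyQuot n⟩
  · rw [← Submodule.Quotient.mk_smul, hmk]
    exact ⟨_, relMap_neg_smul_stdVec_last n⟩
  · rw [Ne, ← Subtype.coe_inj]
    exact fun h => socleGen_notMem_range n ((hmk _).1 h)
  · rintro ⟨m, hm⟩
    obtain ⟨w, rfl⟩ := Submodule.Quotient.mk_surjective _ m
    simp only [mem_socle, ← Submodule.Quotient.mk_smul, hmk] at hm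
    obtain ⟨γ, hγ⟩ := exists_sub_C_smul_socleGen_mem_range hm.1 hm.2
    refine ⟨γ, Subtype.ext ?_⟩
    rw [← hmk, Submodule.Quotient.mk_sub, sub_eq_zero] at hγ
    exact hγ.symm

/-- The terms of the Koszul resolution of `ℚ` over `R`. -/
noncomputable def koszulX : ℕ → ModuleCat.{0} RQ
  | 0 => ModuleCat.of RQ RQ
  | 1 => ModuleCat.of RQ (RQ × RQ)
  | 2 => ModuleCat.of RQ RQ
  | _ + 3 => ModuleCat.of RQ PUnit

/-- The Koszul differential `(x, y) ↦ r x + b y`. -/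
noncomputable def koszulOne : RQ × RQ →ₗ[RQ] RQ :=
  LinearMap.coprod (LinearMap.lsmul RQ RQ (X 0)) (LinearMap.lsmul RQ RQ (X 1))

/-- The Koszul differential `z ↦ (b z, -r z)`. -/
noncomputable def koszulTwo : RQ →ₗ[RQ] RQ × RQ :=
  LinearMap.prod (LinearMap.lsmul RQ RQ (X 1)) (-LinearMap.lsmul RQ RQ (X 0))

lemma koszulOne_apply (p : RQ × RQ) : koszulOne p = X 0 * p.1 + X 1 * p.2 := rfl

lemma koszulTwo_apply (z : RQ) : koszulTwo z = (X 1 * z, -(X 0 * z)) := rfl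

/-- The differentials of the Koszul resolution of `ℚ` over `R`. -/
noncomputable def koszulD : ∀ n, koszulX (n + 1) ⟶ koszulX n
  | 0 => ModuleCat.ofHom koszulOne
  | 1 => ModuleCat.ofHom koszulTwo
  | _ + 2 => 0

/-- The Koszul complex of `(r, b)`. -/
noncomputable def koszul : ChainComplex (ModuleCat.{0} RQ) ℕ :=
  ChainComplex.of koszulX koszulD fun n => by
    match n with
    | 0 =>
      ext
      change koszulOne (koszulTwo _) = 0
      rw [koszulOne_apply, koszulTwo_apply]
      ring
    | n + 1 => exact Limits.zero_comp

lemma koszul_d (n : ℕ) : koszul.d (n + 1) n = koszulD n := ChainComplex.of_d ..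

/-- The augmentation `R → ℚ`. -/
noncomputable def augMap : RQ →ₗ[RQ] QAug where
  toFun p := (aeval (fun _ : Fin 2 => (0 : ℚ)) p : ℚ)
  map_add' := map_add (aeval (fun _ : Fin 2 => (0 : ℚ)))
  map_smul' := map_mul (aeval (fun _ : Fin 2 => (0 : ℚ)))

lemma augMap_eq_zero_iff (p : RQ) : augMap p = 0 ↔ constantCoeff p = 0 := by
  exact Eq.congr_left (aeval_zero' (R := ℚ) (S₁ := ℚ) p)

lemma augMap_surjective : Function.Surjective augMap := fun q =>
  ⟨C (show ℚ from q), aeval_C (fun _ : Fin 2 => (0 : ℚ)) _⟩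

lemma koszulOne_koszulTwo_exact : Function.Exact koszulTwo koszulOne := by
  rintro ⟨x, y⟩
  constructor
  · intro h
    rw [koszulOne_apply] at h
    obtain ⟨z, rfl⟩ : (X 1 : RQ) ∣ x :=
      ((X_prime (R := ℚ) (i := (1 : Fin 2))).dvd_or_dvd (a := X 0) (b := x)
        ⟨-y, by linear_combination h⟩).resolve_left (by simp [X_dvd_X])
    refine ⟨z, ?_⟩
    rw [koszulTwo_apply]
    have : (X 1 : RQ) * (X 0 * z + y) = 0 := by linear_combination h
    have := (mul_eq_zero.1 this).resolve_left (X_ne_zero _)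
    ext1
    · rfl
    · simp only; linear_combination -this
  · rintro ⟨z, hz⟩
    rw [← hz, koszulOne_apply, koszulTwo_apply]
    ring

lemma koszulOne_augMap_exact : Function.Exact koszulOne augMap := by
  intro c
  rw [augMap_eq_zero_iff]
  constructor
  · intro h
    obtain ⟨γ, p, q, rfl⟩ := exists_eq_C_add c
    obtain rfl : γ = 0 := by simpa using h
    exact ⟨(q, p), by rw [koszulOne_apply, C_0]; ring⟩
  · rintro ⟨p, rfl⟩
    simp [koszulOne_apply]

lemma koszulTwo_injective : Function.Injective koszulTwo := fun _ _ h =>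
  mul_left_cancel₀ (X_ne_zero (R := ℚ) (1 : Fin 2)) (congrArg Prod.fst h)

instance koszul_projective (n : ℕ) : Projective (koszul.X n) := by
  change Projective (koszulX n)
  match n with
  | 0 => exact ModuleCat.projective_of_free (Module.Free.chooseBasis RQ RQ)
  | 1 => exact ModuleCat.projective_of_free (Module.Free.chooseBasis RQ (RQ × RQ))
  | 2 => exact ModuleCat.projective_of_free (Module.Free.chooseBasis RQ RQ)
  | _ + 3 => exact ModuleCat.projective_of_free (Module.Free.chooseBasis RQ PUnit)

lemma koszul_exactAt_succ (n : ℕ) : koszul.ExactAt (n + 1) := by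
  rw [HomologicalComplex.exactAt_iff' _ (n + 2) (n + 1) n (by simp) (by simp),
    ShortComplex.moduleCat_exact_iff]
  dsimp only [HomologicalComplex.sc', HomologicalComplex.shortComplexFunctor']
  rw [koszul_d, koszul_d]
  match n with
  | 0 => exact fun x hx => (koszulOne_koszulTwo_exact x).1 hx
  | 1 => exact fun x hx => ⟨0, (map_zero _).trans
      (koszulTwo_injective (hx.trans (map_zero koszulTwo).symm)).symm⟩
  | n + 2 => exact fun x _ => ⟨0, Subsingleton.elim (α := PUnit) _ _⟩

/-- The Koszul resolution of `ℚ` over `R`. -/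
noncomputable def koszulResolution : ProjectiveResolution (ModuleCat.of RQ QAug) where
  complex := koszul
  π := (ChainComplex.toSingle₀Equiv _ _).symm ⟨ModuleCat.ofHom augMap, by
    rw [koszul_d]
    ext x
    exact koszulOne_augMap_exact.apply_apply_eq_zero _⟩
  quasiIso := ⟨fun n => by
    cases n
    · rw [ChainComplex.quasiIsoAt₀_iff, ShortComplex.quasiIso_iff_of_zeros' _ rfl rfl rfl]
      refine ⟨?_, ?_⟩
      · rw [ShortComplex.moduleCat_exact_iff]
        dsimp only [HomologicalComplex.sc', HomologicalComplex.shortComplexFunctor']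
        intro x hx
        obtain ⟨p, hp⟩ := (koszulOne_augMap_exact x).1 hx
        exact ⟨p, (congrArg (fun f => f.hom p) (koszul_d 0)).trans hp⟩
      · exact (ModuleCat.epi_iff_surjective _).2 augMap_surjective
    · rw [quasiIsoAt_iff_exactAt' (hL := ChainComplex.exactAt_succ_single_obj ..)]
      exact koszul_exactAt_succ _⟩

section

open TensorProduct

/-- Tensoring the second Koszul differential with `M` and identifying `M ⊗ R` with `M`, the
kernel is the socle of `M`. -/
noncomputable def socleEquivKer (M : Type) [AddCommGroup M] [Module RQ M] :
    socle M ≃ₗ[RQ] LinearMap.ker (koszulTwo.lTensor M) :=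
  LinearEquiv.ofSubmodules (TensorProduct.rid RQ M).symm _ _ <| by
    ext t
    obtain ⟨m, rfl⟩ := (TensorProduct.rid RQ M).symm.surjective t
    have key : TensorProduct.prodRight RQ RQ M RQ RQ (koszulTwo.lTensor M (m ⊗ₜ 1)) =
        (((X 1 : RQ) • m) ⊗ₜ 1, -(((X 0 : RQ) • m) ⊗ₜ 1)) := by
      simp [koszulTwo_apply, TensorProduct.smul_tmul, TensorProduct.tmul_neg]
    have hone (x : M) : x ⊗ₜ[RQ] (1 : RQ) = 0 ↔ x = 0 := by
      rw [← TensorProduct.rid_symm_apply, LinearEquiv.map_eq_zero_iff]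
    rw [LinearMap.mem_ker, ← LinearEquiv.map_eq_zero_iff (TensorProduct.prodRight RQ RQ M RQ RQ),
      TensorProduct.rid_symm_apply, key]
    rw [← TensorProduct.rid_symm_apply, Submodule.mem_map_equiv, LinearEquiv.symm_symm,
      LinearEquiv.apply_symm_apply, mem_socle, Prod.mk_eq_zero, neg_eq_zero, hone, hone, and_comm]

end

lemma torTwo_equiv_socle (N : ℕ) : Nonempty (torTwo N ≃ₗ[RQ] socle (MN N)) := by
  let F := (MonoidalCategory.tensoringLeft (ModuleCat.{0} RQ)).obj (ModuleCat.of RQ (MN N))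
  let K := (F.mapHomologicalComplex (ComplexShape.down ℕ)).obj koszul
  have h32 : K.d 3 2 = 0 := by
    change F.map (koszul.d 3 2) = 0
    rw [koszul_d]
    exact F.map_zero _ _
  have h21 : K.d 2 1 = ModuleCat.ofHom (koszulTwo.lTensor (MN N)) := by
    change F.map (koszul.d 2 1) = _
    rw [koszul_d]
    rfl
  let e₁ : torTwo N ≅ K.homology 2 := koszulResolution.isoLeftDerivedObj F 2
  let e₂ : K.cycles 2 ≅ K.homology 2 := K.isoHomologyπ 3 2 (by simp) h32
  let e₃ : K.cycles 2 ≅ (K.sc' 3 2 1).cycles := K.cyclesIsoSc' 3 2 1 (by simp) (by simp)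
  let e₄ := (K.sc' 3 2 1).moduleCatCyclesIso
  have e₅ : LinearMap.ker (K.sc' 3 2 1).g.hom = LinearMap.ker (koszulTwo.lTensor (MN N)) := by
    change LinearMap.ker (K.d 2 1).hom = _
    rw [h21]
    rfl
  let e₆ : LinearMap.ker (K.sc' 3 2 1).g.hom ≃ₗ[RQ]
      LinearMap.ker (koszulTwo.lTensor (MN N)) := LinearEquiv.ofEq _ _ e₅
  exact ⟨(e₁ ≪≫ e₂.symm ≪≫ e₃ ≪≫ e₄).toLinearEquiv ≪≫ₗ e₆ ≪≫ₗ
    (socleEquivKer (MN N)).symm⟩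

/-- **Example 9.1 (ex:MVConnectingMap), Tor computation.** Over `R = ℚ[r,b]`, with
`M_N = R^N / (r·x₁, r·x_j − b·x_{j−1} (2 ≤ j ≤ N), b·x_N)` and `ℚ` the augmentation
module, `Tor₂^R(M_N, ℚ)` is a one-dimensional `ℚ`-vector space; in particular nonzero. -/
theorem finrank_torTwo_eq_one (N : ℕ) (hN : 1 ≤ N) :
    Module.finrank ℚ ((ModuleCat.restrictScalars (algebraMap ℚ RQ)).obj (torTwo N)) = 1 ∧
      Nontrivial (torTwo N) := by
  obtain ⟨e⟩ := torTwo_equiv_socle N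
  obtain ⟨m, hm, h⟩ := exists_socle_generator N hN
  have hne : e.symm m ≠ 0 := by simpa using hm
  refine ⟨?_, ⟨_, _, hne⟩⟩
  refine _root_.finrank_eq_one (R := ℚ)
    (M := (ModuleCat.restrictScalars (algebraMap ℚ RQ)).obj (torTwo N)) (e.symm m) hne fun t => ?_
  obtain ⟨γ, hγ⟩ := h (e t)
  refine ⟨γ, ?_⟩
  change (C γ : RQ) • e.symm m = t
  rw [← map_smul, hγ]
  exact e.symm_apply_apply t
end
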